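/- Let Z : ℕ → ℝ be a sequence such that for every z ∈ [0,1/4) the series ∑_{p≥0} Z(p)·z^p converges with sum (1 + 7z - 8z² + √((1-z)(1-4z)³)) / (2(1-z)). Then Z(0) = 1, and 4^{-p}·p^{5/2}·Z(p) converges to (1/4)·√(3/π) as p → ∞; equivalently, Z(p) ~ (1/4)·√(3/π)·4^p·p^{-5/2}. -/

import Mathlib

open Filter Topology Finset

/-- The binomial series of `(1 - x) ^ (-a)`. -/
theorem Real.hasSum_multichoose_mul_pow (a : ℝ) {x : ℝ} (hx : |x| < 1) :
    HasSum (fun n : ℕ => Ring.multichoose a n * x ^ n) ((1 - x) ^ (-a)) := by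
  have hmem : x ∈ Metric.eball (0 : ℝ) 1 := by
    simpa [enorm_eq_nnnorm, ← NNReal.coe_lt_coe] using hx
  have h := (Real.one_div_one_sub_rpow_hasFPowerSeriesOnBall_zero a).hasSum hmem
  have hpos : 0 ≤ 1 - x := by linarith [(abs_lt.mp hx).2]
  simpa [FormalMultilinearSeries.ofScalars_apply_eq, Ring.multichoose_eq, Real.rpow_neg hpos,
    mul_comm] using h

theorem Ring.multichoose_eq_prod_div_factorial (a : ℝ) (n : ℕ) :
    Ring.multichoose a n = (∏ j ∈ range n, (a + j)) / n.factorial := by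
  have h := Ring.factorial_nsmul_multichoose_eq_ascPochhammer a n
  rw [Polynomial.ascPochhammer_smeval_eq_eval, nsmul_eq_mul] at h
  rw [eq_div_iff (by positivity), mul_comm, h]
  clear h
  induction n with
  | zero => simp
  | succ n ih => rw [ascPochhammer_succ_eval, ih, prod_range_succ]

theorem Real.tendsto_rpow_mul_multichoose {a : ℝ} (ha : ∀ m : ℕ, a ≠ -m) :
    Tendsto (fun n : ℕ => (n : ℝ) ^ (1 - a) * Ring.multichoose a n) atTop
      (𝓝 (Real.Gamma a)⁻¹) := by
  have hG := (Real.GammaSeq_tendsto_Gamma a).inv₀ (Real.Gamma_ne_zero ha)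
  have hq : Tendsto (fun n : ℕ => (n : ℝ) / (n + a)) atTop (𝓝 1) :=
    tendsto_natCast_div_add_atTop a
  have h := hq.mul hG
  rw [one_mul] at h
  refine h.congr' ?_
  filter_upwards [eventually_gt_atTop 0] with n hn
  have hn' : (0 : ℝ) < n := by exact_mod_cast hn
  have hna : (n : ℝ) + a ≠ 0 := fun h0 => ha n (by linarith)
  have hpow : (n : ℝ) ^ a ≠ 0 := (Real.rpow_pos_of_pos hn' a).ne'
  have hfac : (n.factorial : ℝ) ≠ 0 := by positivity
  rw [Real.GammaSeq, Ring.multichoose_eq_prod_div_factorial, prod_range_succ,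
    Real.rpow_sub hn', Real.rpow_one]
  field_simp
  ring

/-- A real power series vanishing on an interval `[0, r)` has zero coefficients. -/
theorem eq_zero_of_hasSum_mul_pow_zero {d : ℕ → ℝ} {r : ℝ} (hr : 0 < r)
    (h : ∀ z ∈ Set.Ico 0 r, HasSum (fun n => d n * z ^ n) 0) : d = 0 := by
  set p := FormalMultilinearSeries.ofScalars ℝ d with hp
  have hrad : 0 < p.radius := by
    have hs := (h (r / 2) ⟨by positivity, by linarith⟩).summable.tendsto_atTop_zero
    have h0 : Tendsto (fun n => ‖p n‖ * ((⟨r / 2, by positivity⟩ : NNReal) : ℝ) ^ n) atTop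
        (𝓝 0) := by
      refine hs.norm.congr' ?_ |>.trans (by simp)
      filter_upwards with n
      simp [hp, abs_of_pos hr]
    refine lt_of_lt_of_le ?_ (p.le_radius_of_tendsto h0)
    exact ENNReal.coe_pos.mpr (NNReal.coe_pos.mp (half_pos hr))
  have hball := p.hasFPowerSeriesOnBall hrad
  have hfreq : ∃ᶠ z in 𝓝[≠] (0 : ℝ), p.sum z = 0 := by
    have : ∀ᶠ z in 𝓝[>] (0 : ℝ), p.sum z = 0 := by
      filter_upwards [Ioo_mem_nhdsGT hr] with z hz
      simpa [FormalMultilinearSeries.sum, hp, FormalMultilinearSeries.ofScalars_apply_eq, mul_comm]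
        using (h z ⟨hz.1.le, hz.2⟩).tsum_eq
    exact this.frequently.filter_mono (nhdsWithin_mono _ fun z hz => ne_of_gt hz)
  have hev := (hball.analyticAt.frequently_eq_iff_eventually_eq analyticAt_const).mp hfreq
  have hp0 := hball.hasFPowerSeriesAt.eq_zero_of_eventually hev
  exact (FormalMultilinearSeries.ofScalars_series_eq_zero (E := ℝ)).mp hp0

theorem tendsto_natCast_rpow_mul_comp_sub {b : ℕ → ℝ} {s L : ℝ}
    (hb : Tendsto (fun n : ℕ => (n : ℝ) ^ s * b n) atTop (𝓝 L)) (k : ℕ) :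
    Tendsto (fun n : ℕ => (n : ℝ) ^ s * b (n - k)) atTop (𝓝 L) := by
  rw [← tendsto_add_atTop_iff_nat k]
  have hq : Tendsto (fun n : ℕ => ((n : ℝ) / (n + k)) ^ (-s)) atTop (𝓝 1) := by
    simpa using (tendsto_natCast_div_add_atTop (k : ℝ)).rpow_const (p := -s) (Or.inl one_ne_zero)
  have h := hq.mul hb
  rw [one_mul] at h
  refine h.congr' ?_
  filter_upwards [eventually_gt_atTop 0] with n hn
  have hn' : (0 : ℝ) < n := by exact_mod_cast hn
  have hpow : (n : ℝ) ^ s ≠ 0 := (Real.rpow_pos_of_pos hn' s).ne'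
  rw [Nat.add_sub_cancel, Real.rpow_neg (by positivity), Real.div_rpow hn'.le (by positivity)]
  push_cast
  field_simp

/-- If `b n` is asymptotic to `L * n ^ (-s)` and `a` is summable against `(n + 1) ^ s`, then the
Cauchy product of `a` and `b` is asymptotic to `(∑ a) * L * n ^ (-s)`. -/
theorem tendsto_rpow_mul_sum_range_mul {a b : ℕ → ℝ} {s L : ℝ} (hs : 0 ≤ s)
    (ha : Summable fun k : ℕ => |a k| * ((k : ℝ) + 1) ^ s)
    (hb : Tendsto (fun n : ℕ => (n : ℝ) ^ s * b n) atTop (𝓝 L)) :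
    Tendsto (fun n : ℕ => (n : ℝ) ^ s * ∑ k ∈ range (n + 1), a k * b (n - k)) atTop
      (𝓝 ((∑' k, a k) * L)) := by
  obtain ⟨M, hM⟩ : ∃ M, ∀ n : ℕ, |((n : ℝ) + 1) ^ s * b n| ≤ M := by
    have h := (tendsto_add_atTop_iff_nat 1).mpr (tendsto_natCast_rpow_mul_comp_sub hb 1)
    obtain ⟨M, hM⟩ := h.abs.bddAbove_range
    exact ⟨M, fun n => by simpa using hM ⟨n, rfl⟩⟩
  have key := tendsto_tsum_of_dominated_convergence (𝓕 := atTop)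
    (f := fun (n k : ℕ) => if k ∈ range (n + 1) then a k * ((n : ℝ) ^ s * b (n - k)) else 0)
    (g := fun k => a k * L) (ha.mul_right M) ?_ ?_
  · rw [tsum_mul_right] at key
    refine key.congr fun n => ?_
    rw [tsum_eq_sum (s := range (n + 1)) (fun k hk => if_neg hk), mul_sum]
    refine sum_congr rfl fun k hk => ?_
    rw [if_pos hk]
    ring
  · intro k
    refine ((tendsto_natCast_rpow_mul_comp_sub hb k).const_mul (a k)).congr' ?_
    filter_upwards [eventually_ge_atTop k] with n hn
    rw [if_pos (mem_range.mpr (by omega))]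
  · filter_upwards with n k
    have hM0 : 0 ≤ M := (abs_nonneg _).trans (hM 0)
    split_ifs with hk
    · obtain ⟨m, rfl⟩ : ∃ m, n = k + m := ⟨n - k, by have := mem_range.mp hk; omega⟩
      have hle : ((k + m : ℕ) : ℝ) ^ s ≤ ((k : ℝ) + 1) ^ s * ((m : ℝ) + 1) ^ s := by
        rw [← Real.mul_rpow (by positivity) (by positivity)]
        refine Real.rpow_le_rpow (by positivity) ?_ hs
        push_cast
        nlinarith [mul_nonneg (Nat.cast_nonneg (α := ℝ) k) (Nat.cast_nonneg (α := ℝ) m)]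
      have hMm := hM m
      rw [abs_mul, abs_of_nonneg (by positivity)] at hMm
      rw [Real.norm_eq_abs, abs_mul, abs_mul,
        abs_of_nonneg (by positivity : 0 ≤ ((k + m : ℕ) : ℝ) ^ s),
        Nat.add_sub_cancel_left, mul_assoc]
      refine mul_le_mul_of_nonneg_left ?_ (abs_nonneg _)
      calc ((k + m : ℕ) : ℝ) ^ s * |b m|
          ≤ ((k : ℝ) + 1) ^ s * ((m : ℝ) + 1) ^ s * |b m| := by gcongr
        _ = ((k : ℝ) + 1) ^ s * (((m : ℝ) + 1) ^ s * |b m|) := by ring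
        _ ≤ ((k : ℝ) + 1) ^ s * M := by gcongr
    · rw [norm_zero]
      positivity

theorem Real.summable_abs_multichoose_mul_pow_mul_rpow (a s : ℝ) {x : ℝ} (hx : |x| < 1) :
    Summable fun k : ℕ => |Ring.multichoose a k * x ^ k| * ((k : ℝ) + 1) ^ s := by
  set r := (|x| + 1) / 2 with hr
  have hr0 : 0 < r := by positivity
  have hxr : |x / r| < 1 := by
    rw [abs_div, abs_of_pos hr0, div_lt_one hr0]
    linarith
  obtain ⟨C, hC⟩ : ∃ C, ∀ k : ℕ, |Ring.multichoose a k * (x / r) ^ k| ≤ C := by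
    have h := (Real.hasSum_multichoose_mul_pow a hxr).summable.tendsto_atTop_zero
    obtain ⟨C, hC⟩ := h.abs.bddAbove_range
    exact ⟨C, fun k => hC ⟨k, rfl⟩⟩
  have hgeom : Summable fun k : ℕ => ((k : ℝ) + 1) ^ ⌈s⌉₊ * r ^ k := by
    have h := (summable_nat_add_iff 1).mpr (summable_pow_mul_geometric_of_norm_lt_one ⌈s⌉₊
      (r := r) (by rw [Real.norm_eq_abs, abs_of_pos hr0]; linarith))
    refine (h.mul_right r⁻¹).congr fun k => ?_
    rw [pow_succ, mul_assoc, mul_assoc, mul_inv_cancel₀ hr0.ne', mul_one]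
    push_cast
    rfl
  refine (hgeom.mul_left C).of_nonneg_of_le (fun k => by positivity) fun k => ?_
  calc |Ring.multichoose a k * x ^ k| * ((k : ℝ) + 1) ^ s
      = |Ring.multichoose a k * (x / r) ^ k| * (((k : ℝ) + 1) ^ s * r ^ k) := by
        rw [div_pow, ← mul_div_assoc, abs_div, abs_of_pos (pow_pos hr0 k)]
        field_simp
    _ ≤ C * (((k : ℝ) + 1) ^ ⌈s⌉₊ * r ^ k) := by
        have hpow : ((k : ℝ) + 1) ^ s ≤ ((k : ℝ) + 1) ^ ⌈s⌉₊ := by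
          rw [← Real.rpow_natCast]
          exact Real.rpow_le_rpow_of_exponent_le (by linarith [Nat.cast_nonneg (α := ℝ) k])
            (Nat.le_ceil s)
        have hC0 : 0 ≤ C := (abs_nonneg _).trans (hC k)
        exact mul_le_mul (hC k) (mul_le_mul_of_nonneg_right hpow (by positivity)) (by positivity)
          hC0

theorem Real.Gamma_neg_three_halves : Real.Gamma (-3 / 2) = 4 / 3 * Real.sqrt Real.pi := by
  have h1 := Real.Gamma_add_one (s := -3 / 2) (by norm_num)
  have h2 := Real.Gamma_add_one (s := -1 / 2) (by norm_num)
  rw [show (-3 / 2 : ℝ) + 1 = -1 / 2 by norm_num] at h1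
  rw [show (-1 / 2 : ℝ) + 1 = 1 / 2 by norm_num, Real.Gamma_one_half_eq, h1] at h2
  linarith

/-- The coefficients of `√((1 - z) * (1 - 4 * z) ^ 3) / (1 - z)`, divided by `4 ^ n`. -/
noncomputable def sqrtQuotientCoeff (n : ℕ) : ℝ :=
  ∑ k ∈ range (n + 1),
    (Ring.multichoose (1 / 2 : ℝ) k * (1 / 4) ^ k) * Ring.multichoose (-3 / 2 : ℝ) (n - k)

theorem hasSum_sqrtQuotientCoeff {z : ℝ} (hz : z ∈ Set.Ico (0 : ℝ) (1 / 4)) :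
    HasSum (fun n => sqrtQuotientCoeff n * 4 ^ n * z ^ n)
      (Real.sqrt ((1 - z) * (1 - 4 * z) ^ 3) / (1 - z)) := by
  obtain ⟨h0, h1⟩ := hz
  have ha := Real.hasSum_multichoose_mul_pow (1 / 2) (x := z)
    (by rw [abs_lt]; constructor <;> linarith)
  have hb := Real.hasSum_multichoose_mul_pow (-3 / 2) (x := 4 * z)
    (by rw [abs_lt]; constructor <;> linarith)
  have h := hasSum_sum_range_mul_of_summable_norm ha.summable.norm hb.summable.norm
  rw [ha.tsum_eq, hb.tsum_eq] at h
  convert! h using 1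
  · funext n
    simp only [sqrtQuotientCoeff, sum_mul]
    refine sum_congr rfl fun k hk => ?_
    obtain ⟨m, rfl⟩ : ∃ m, n = k + m := ⟨n - k, by have := mem_range.mp hk; omega⟩
    rw [Nat.add_sub_cancel_left, pow_add, pow_add, mul_pow, one_div_pow]
    field_simp
  · have hp : 0 < 1 - z := by linarith
    have hq : 0 < 1 - 4 * z := by linarith
    rw [Real.sqrt_mul hp.le, Real.rpow_neg hp.le, ← Real.sqrt_eq_rpow, Real.sqrt_eq_rpow (_ ^ 3),
      ← Real.rpow_natCast, ← Real.rpow_mul hq.le]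
    norm_num
    have := Real.mul_self_sqrt hp.le
    have hs : √(1 - z) ≠ 0 := (Real.sqrt_pos.mpr hp).ne'
    field_simp
    rw [sq, this]

theorem tendsto_rpow_mul_sqrtQuotientCoeff :
    Tendsto (fun n : ℕ => (n : ℝ) ^ (5 / 2 : ℝ) * sqrtQuotientCoeff n) atTop
      (𝓝 ((1 / 2) * Real.sqrt (3 / Real.pi))) := by
  have hb := Real.tendsto_rpow_mul_multichoose (a := -3 / 2) (fun m hm => by
    have h3 : (3 : ℝ) = ((2 * m : ℕ) : ℝ) := by push_cast; linarith
    have : 3 = 2 * m := by exact_mod_cast h3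
    omega)
  rw [show (1 : ℝ) - -3 / 2 = 5 / 2 by norm_num] at hb
  have hx : |(1 / 4 : ℝ)| < 1 := by rw [abs_lt]; norm_num
  have h := tendsto_rpow_mul_sum_range_mul (by norm_num)
    (Real.summable_abs_multichoose_mul_pow_mul_rpow (1 / 2) (5 / 2) hx) hb
  rw [(Real.hasSum_multichoose_mul_pow (1 / 2) hx).tsum_eq, Real.Gamma_neg_three_halves] at h
  refine h.trans (le_of_eq (congrArg 𝓝 ?_))
  rw [Real.rpow_neg (by norm_num), ← Real.sqrt_eq_rpow,
    show (1 - 1 / 4 : ℝ) = 3 / 2 ^ 2 by norm_num,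
    Real.sqrt_div (by norm_num), Real.sqrt_div (by norm_num), Real.sqrt_sq (by norm_num)]
  have h3 : √(3 : ℝ) ≠ 0 := by positivity
  have hpi : √Real.pi ≠ 0 := by positivity
  have := Real.sq_sqrt (show (0 : ℝ) ≤ 3 by norm_num)
  field_simp
  linarith

theorem stmt_11 (Z : ℕ → ℝ)
    (hgen : ∀ z ∈ Set.Ico (0 : ℝ) (1 / 4),
      HasSum (fun p : ℕ => Z p * z ^ p)
        ((1 + 7 * z - 8 * z ^ 2 + Real.sqrt ((1 - z) * (1 - 4 * z) ^ 3)) / (2 * (1 - z)))) :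
    Z 0 = 1 ∧
      Filter.Tendsto (fun p : ℕ => (4 : ℝ) ^ (-(p : ℤ)) * (p : ℝ) ^ (5 / 2 : ℝ) * Z p)
        Filter.atTop (nhds ((1 / 4) * Real.sqrt (3 / Real.pi))) := by
  refine ⟨?_, ?_⟩
  · have h := hgen 0 ⟨le_rfl, by norm_num⟩
    have h' := hasSum_single (f := fun p : ℕ => Z p * (0 : ℝ) ^ p) 0 (fun p hp => by simp [hp])
    have := h.unique h'
    norm_num at this
    exact this.symm
  · have hd := eq_zero_of_hasSum_mul_pow_zero (r := 1 / 4) (by norm_num)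
      (d := fun n => Z n - (1 / 2 * (sqrtQuotientCoeff n * 4 ^ n) +
        ((if n = 0 then 1 / 2 else 0) + if n = 1 then 4 else 0))) (fun z hz => by
        have h0 : HasSum (fun n : ℕ => (if n = 0 then (1 / 2 : ℝ) else 0) * z ^ n) (1 / 2) := by
          convert! hasSum_single (f := fun n : ℕ => (if n = 0 then (1 / 2 : ℝ) else 0) * z ^ n) 0
            (fun n hn => by simp [hn]) using 1
          simp
        have h1 : HasSum (fun n : ℕ => (if n = 1 then (4 : ℝ) else 0) * z ^ n) (4 * z) := by
          convert! hasSum_single (f := fun n : ℕ => (if n = 1 then (4 : ℝ) else 0) * z ^ n) 1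
            (fun n hn => by simp [hn]) using 1
          simp
        have h := (hgen z hz).sub
          (((hasSum_sqrtQuotientCoeff hz).mul_left (1 / 2)).add (h0.add h1))
        convert! h using 1
        · funext n
          ring
        · have : 1 - z ≠ 0 := by have := hz.2; intro h; linarith
          field_simp
          ring)
    have h := tendsto_rpow_mul_sqrtQuotientCoeff.const_mul (1 / 2)
    convert h.congr' ?_ using 2
    · ring
    · filter_upwards [eventually_ge_atTop 2] with n hn
      have hn0 : n ≠ 0 := by omega
      have hn1 : n ≠ 1 := by omega
      have hZ := congrFun hd n
      simp only [hn0, hn1, if_false, Pi.zero_apply, add_zero, sub_eq_zero] at hZ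
      rw [hZ, zpow_neg, zpow_natCast]
      field_simp
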